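/- Let (X,d) be a compact metric space, f : X → X a continuous map, x ∈ X, and C a chain component of f with ω(x,f) ⊆ C. If C is terminal (i.e. chain stable), then C(x) = {f^i(x) : i ≥ 0} ∪ C. -/

import Mathlib

open Filter Topology Set

section Defs

variable {X : Type*} [MetricSpace X]

/-- `c 0, c 1, ..., c k` is a `δ`-chain of `f`. -/
def IsDeltaChain (f : X → X) (δ : ℝ) (c : ℕ → X) (k : ℕ) : Prop :=
  ∀ i < k, dist (f (c i)) (c (i + 1)) ≤ δ

/-- `x → y` : for every `δ > 0` there is a `δ`-chain of `f` from `x` to `y`. -/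
def ChainReach (f : X → X) (x y : X) : Prop :=
  ∀ δ > 0, ∃ (c : ℕ → X) (k : ℕ), 1 ≤ k ∧ IsDeltaChain f δ c k ∧ c 0 = x ∧ c k = y

/-- `C(x) = {x} ∪ {y : x → y}`. -/
def CSet (f : X → X) (x : X) : Set X := {x} ∪ {y | ChainReach f x y}

/-- The chain recurrent set. -/
def CR (f : X → X) : Set X := {x | ChainReach f x x}

/-- `C` is a chain component of `f` : an equivalence class of `↔` on `CR f`. -/
def IsChainComponent (f : X → X) (C : Set X) : Prop :=
  ∃ x ∈ CR f, C = {y ∈ CR f | ChainReach f x y ∧ ChainReach f y x}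

/-- A set `S` is chain stable for `f`. -/
def ChainStable (f : X → X) (S : Set X) : Prop :=
  ∀ ε > 0, ∃ δ > 0, ∀ (c : ℕ → X) (k : ℕ), 1 ≤ k → IsDeltaChain f δ c k → c 0 ∈ S →
    ∀ i ≤ k, Metric.infDist (c i) S ≤ ε

/-- `ξ` is a `δ`-pseudo orbit of `f`. -/
def IsPseudoOrbit (f : X → X) (δ : ℝ) (ξ : ℕ → X) : Prop :=
  ∀ i, dist (f (ξ i)) (ξ (i + 1)) ≤ δ

/-- `x` is a shadowable point of `f`. -/
def ShadowablePt (f : X → X) (x : X) : Prop :=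
  ∀ ε > 0, ∃ δ > 0, ∀ ξ : ℕ → X, IsPseudoOrbit f δ ξ → ξ 0 = x →
    ∃ y, ∀ i, dist (f^[i] y) (ξ i) ≤ ε

/-- `f` has the shadowing on `S`. -/
def ShadowingOn (f : X → X) (S : Set X) : Prop :=
  ∀ ε > 0, ∃ δ > 0, ∀ ξ : ℕ → X, IsPseudoOrbit f δ ξ → (∀ i, ξ i ∈ S) →
    ∃ y, ∀ i, dist (f^[i] y) (ξ i) ≤ ε

/-- `f` has the shadowing property. -/
def ShadowingProperty (f : X → X) : Prop :=
  ∀ ε > 0, ∃ δ > 0, ∀ ξ : ℕ → X, IsPseudoOrbit f δ ξ →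
    ∃ y, ∀ i, dist (f^[i] y) (ξ i) ≤ ε

/-- `f` is chain transitive. -/
def ChainTransitive (f : X → X) : Prop := ∀ x y : X, ChainReach f x y

/-- `f` restricted to `S` is chain continuous. -/
def ChainContinuousOn (f : X → X) (S : Set X) : Prop :=
  ∀ ε > 0, ∃ δ > 0, ∀ ξ η : ℕ → X, IsPseudoOrbit f δ ξ → IsPseudoOrbit f δ η →
    (∀ i, ξ i ∈ S) → (∀ i, η i ∈ S) → ξ 0 = η 0 → ∀ i, dist (ξ i) (η i) ≤ ε

/-- `f` restricted to `S` is equicontinuous. -/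
def EquicontinuousOnSet (f : X → X) (S : Set X) : Prop :=
  ∀ ε > 0, ∃ δ > 0, ∀ x ∈ S, ∀ y ∈ S, dist x y ≤ δ → ∀ i : ℕ, dist (f^[i] x) (f^[i] y) ≤ ε

/-- `s_n(f,K,r)` : largest cardinality of an `(n,r)`-separated subset of `K`. -/
noncomputable def sepNum (f : X → X) (K : Set X) (n : ℕ) (r : ℝ) : ℕ :=
  sSup {m | ∃ E : Finset X, (E : Set X) ⊆ K ∧
    (∀ x ∈ E, ∀ y ∈ E, x ≠ y → ∃ i < n, r < dist (f^[i] x) (f^[i] y)) ∧ E.card = m}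

/-- `h(f,K,r) = limsup (1/n) log s_n(f,K,r)`. -/
noncomputable def entH (f : X → X) (K : Set X) (r : ℝ) : EReal :=
  Filter.limsup (fun n : ℕ => ((Real.log (sepNum f K n r) / n : ℝ) : EReal)) Filter.atTop

/-- `h(f,K) = lim_{r → 0} h(f,K,r) = sup_{r > 0} h(f,K,r)`. -/
noncomputable def ent (f : X → X) (K : Set X) : EReal :=
  ⨆ r ∈ Set.Ioi (0 : ℝ), entH f K r

/-- `Ent_r(f)`. -/
def EntR (f : X → X) (r : ℝ) : Set X :=
  {x | ∀ K : Set X, IsClosed K → K ∈ 𝓝 x → 0 < entH f K r}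

/-- `Ent_{r,b}(f)`. -/
def EntRB (f : X → X) (r b : ℝ) : Set X :=
  {x | ∀ K : Set X, IsClosed K → K ∈ 𝓝 x → (b : EReal) ≤ entH f K r}

/-- The ω-limit set of `x` under `f`. -/
def omegaLim (f : X → X) (x : X) : Set X :=
  {y | ∃ φ : ℕ → ℕ, StrictMono φ ∧ Tendsto (fun j => f^[φ j] x) atTop (𝓝 y)}

/-- The set of `e`-sensitive points of `f` restricted to `S`. -/
def SenE (f : X → X) (S : Set X) (e : ℝ) : Set X :=
  {x ∈ S | ∀ ε > 0, ∃ y ∈ S, dist x y ≤ ε ∧ ∃ i : ℕ, e < dist (f^[i] x) (f^[i] y)}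

/-- `Sen(f|_S) = ⋃_{e > 0} Sen_e(f|_S)`. -/
def Sen (f : X → X) (S : Set X) : Set X := ⋃ e ∈ Set.Ioi (0 : ℝ), SenE f S e

/-- `(x,y)` is a scrambled pair for `f`. -/
def ScrambledPair (f : X → X) (x y : X) : Prop :=
  0 < Filter.limsup (fun i : ℕ => dist (f^[i] x) (f^[i] y)) Filter.atTop ∧
    Filter.liminf (fun i : ℕ => dist (f^[i] x) (f^[i] y)) Filter.atTop = 0

/-- `M` is a minimal set for `f`. -/
def IsMinimalSet (f : X → X) (M : Set X) : Prop :=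
  IsClosed M ∧ MapsTo f M M ∧ ∀ S ⊆ M, IsClosed S → MapsTo f S S → S = ∅ ∨ S = M

/-- `Φ_ε(x)`. -/
def Phi (f : X → X) (ε : ℝ) (x : X) : Set X :=
  {y | ∀ i : ℕ, dist (f^[i] x) (f^[i] y) ≤ ε}

/-- `h*_f(ε) = sup_x h(f,Φ_ε(x))`. -/
noncomputable def hStar (f : X → X) (ε : ℝ) : EReal := ⨆ x : X, ent f (Phi f ε x)

/-- `f` is h-expansive. -/
def HExpansive (f : X → X) : Prop := ∃ ε > 0, hStar f ε = 0

end Defs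

theorem ChainReach.trans {X : Type*} [MetricSpace X] {f : X → X} {x y z : X}
    (hxy : ChainReach f x y) (hyz : ChainReach f y z) : ChainReach f x z := by
  intro δ hδ
  obtain ⟨c, k, hk, hc, hc0, hck⟩ := hxy δ hδ
  obtain ⟨e, m, hm, he, he0, hem⟩ := hyz δ hδ
  refine ⟨fun i => if i ≤ k then c i else e (i - k), k + m, by omega, ?_, by simp [hc0], ?_⟩
  · intro i hi
    rcases lt_trichotomy i k with h | h | h
    · simpa [h.le, Nat.succ_le_of_lt h] using hc i h
    · subst h
      simpa [hck, he0] using he 0 (by omega)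
    · have h1 : ¬ i ≤ k := by omega
      have h2 : ¬ i + 1 ≤ k := by omega
      have h3 : i + 1 - k = i - k + 1 := by omega
      simpa [h1, h2, h3] using he (i - k) (by omega)
  · have h : ¬ k + m ≤ k := by omega
    simp [h, hem]

theorem chainReach_iterate {X : Type*} [MetricSpace X] (f : X → X) (x : X) {n : ℕ}
    (hn : 1 ≤ n) : ChainReach f x (f^[n] x) := by
  intro δ hδ
  refine ⟨fun i => f^[i] x, n, hn, fun i _ => ?_, rfl, rfl⟩
  simp [Function.iterate_succ_apply', hδ.le]

/-- The set of points chain reachable from a given point is closed. -/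
theorem isClosed_setOf_chainReach {X : Type*} [MetricSpace X] (f : X → X) (x : X) :
    IsClosed {y | ChainReach f x y} := by
  refine isClosed_of_closure_subset fun y hy δ hδ => ?_
  obtain ⟨z, hz, hyz⟩ := Metric.mem_closure_iff.1 hy (δ / 2) (half_pos hδ)
  obtain ⟨c, k, hk, hc, hc0, hck⟩ := hz (δ / 2) (half_pos hδ)
  refine ⟨fun i => if i = k then y else c i, k, hk, fun i hi => ?_, ?_, by simp⟩
  · have h := hc i hi
    by_cases h1 : i + 1 = k
    · have h2 := dist_triangle (f (c i)) z y
      rw [h1, hck] at h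
      rw [dist_comm] at hyz
      simp only [hi.ne, h1, if_true, if_false]
      linarith
    · simp only [hi.ne, h1, if_false]
      linarith
  · have h : 0 ≠ k := by omega
    simp [h, hc0]

/-- For a continuous map, the set of points that chain reach a given point is closed. -/
theorem isClosed_setOf_chainReach_left {X : Type*} [MetricSpace X] {f : X → X}
    (hf : Continuous f) (y : X) : IsClosed {x | ChainReach f x y} := by
  refine isClosed_of_closure_subset fun x hx δ hδ => ?_
  obtain ⟨η, hη, hfη⟩ := Metric.continuous_iff.1 hf x (δ / 2) (half_pos hδ)
  obtain ⟨z, hz, hxz⟩ := Metric.mem_closure_iff.1 hx η hη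
  obtain ⟨c, k, hk, hc, hc0, hck⟩ := hz (δ / 2) (half_pos hδ)
  refine ⟨fun i => if i = 0 then x else c i, k, hk, fun i hi => ?_, by simp, ?_⟩
  · have h := hc i hi
    rcases Nat.eq_zero_or_pos i with rfl | h0
    · have h1 := dist_triangle_left (f x) (c (0 + 1)) (f z)
      have h2 := hfη z (by rwa [dist_comm])
      rw [hc0] at h
      simp only [if_true, Nat.add_eq_zero_iff, one_ne_zero, and_false, if_false]
      linarith
    · simp only [h0.ne', if_false, Nat.add_eq_zero_iff, one_ne_zero, and_false]
      linarith
  · have h : k ≠ 0 := by omega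
    simp [h, hck]

theorem IsChainComponent.isClosed {X : Type*} [MetricSpace X] {f : X → X}
    (hf : Continuous f) {C : Set X} (hC : IsChainComponent f C) : IsClosed C := by
  obtain ⟨z, -, rfl⟩ := hC
  convert (isClosed_setOf_chainReach f z).inter (isClosed_setOf_chainReach_left hf z) using 1
  ext y
  exact ⟨fun h => h.2, fun h => ⟨h.2.trans h.1, h⟩⟩

theorem IsChainComponent.chainReach {X : Type*} [MetricSpace X] {f : X → X} {C : Set X}
    (hC : IsChainComponent f C) {y z : X} (hy : y ∈ C) (hz : z ∈ C) : ChainReach f y z := by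
  obtain ⟨w, -, rfl⟩ := hC
  exact hy.2.2.trans hz.2.1

theorem chainReach_of_mem_omegaLim {X : Type*} [MetricSpace X] {f : X → X} {x p : X}
    (hp : p ∈ omegaLim f x) : ChainReach f x p := by
  obtain ⟨φ, hφ, hlim⟩ := hp
  refine (isClosed_setOf_chainReach f x).mem_of_tendsto hlim ?_
  filter_upwards [eventually_ge_atTop 1] with j hj
  exact chainReach_iterate f x (hj.trans (hφ.id_le j))

theorem omegaLim_nonempty {X : Type*} [MetricSpace X] [CompactSpace X] (f : X → X) (x : X) :
    (omegaLim f x).Nonempty := by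
  obtain ⟨p, φ, hφ, hlim⟩ := CompactSpace.tendsto_subseq (fun n => f^[n] x)
  exact ⟨p, φ, hφ, hlim⟩

/-- Fine enough chains from `x` follow the orbit of `x` for a prescribed finite time. -/
theorem exists_delta_chain_dist_iterate_le {X : Type*} [MetricSpace X] {f : X → X}
    (hf : Continuous f) (x : X) (n : ℕ) {ε : ℝ} (hε : 0 < ε) :
    ∃ δ > 0, ∀ (c : ℕ → X) (k : ℕ), IsDeltaChain f δ c k → c 0 = x → n ≤ k →
      dist (c n) (f^[n] x) ≤ ε := by
  induction n generalizing ε with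
  | zero => exact ⟨1, one_pos, fun c k _ h _ => by simp [h, hε.le]⟩
  | succ n ih =>
    obtain ⟨η, hη, hfη⟩ := Metric.continuous_iff.1 hf (f^[n] x) (ε / 2) (half_pos hε)
    obtain ⟨δ, hδ, h⟩ := ih (half_pos hη)
    refine ⟨min δ (ε / 2), lt_min hδ (half_pos hε), fun c k hc hc0 hk => ?_⟩
    have h1 := h c k (fun i hi => (hc i hi).trans (min_le_left _ _)) hc0 (by omega)
    have h2 := hfη (c n) (by linarith)
    have h3 := (hc n hk).trans (min_le_right _ _)
    rw [Function.iterate_succ_apply']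
    linarith [dist_triangle_left (c (n + 1)) (f (f^[n] x)) (f (c n))]

/-- If `y` is reached from `x` but is not on the orbit of `x`, then chains of bounded length
from `x` to `y` cannot be arbitrarily fine. -/
theorem exists_delta_chain_length_gt {X : Type*} [MetricSpace X] {f : X → X}
    (hf : Continuous f) {x y : X} (hy : ∀ i, f^[i] x ≠ y) (n : ℕ) :
    ∃ δ > 0, ∀ (c : ℕ → X) (k : ℕ), IsDeltaChain f δ c k → c 0 = x → c k = y → n < k := by
  have key (i : ℕ) : ∃ δ > 0, ∀ c : ℕ → X, IsDeltaChain f δ c i → c 0 = x → c i ≠ y := by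
    have hpos : 0 < dist y (f^[i] x) := dist_pos.2 (hy i).symm
    obtain ⟨δ, hδ, h⟩ := exists_delta_chain_dist_iterate_le hf x i (half_pos hpos)
    refine ⟨δ, hδ, fun c hc hc0 hci => ?_⟩
    have := h c i hc hc0 le_rfl
    rw [hci] at this
    linarith
  induction n with
  | zero =>
    refine ⟨1, one_pos, fun c k _ hc0 hck => Nat.pos_of_ne_zero ?_⟩
    rintro rfl
    exact hy 0 (hc0.symm.trans hck)
  | succ n ih =>
    obtain ⟨δ, hδ, h⟩ := ih
    obtain ⟨η, hη, h'⟩ := key (n + 1)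
    refine ⟨min δ η, lt_min hδ hη, fun c k hc hc0 hck => ?_⟩
    have h1 := h c k (fun i hi => (hc i hi).trans (min_le_left _ _)) hc0 hck
    refine lt_of_le_of_ne h1 ?_
    rintro rfl
    exact h' c (fun i hi => (hc i hi).trans (min_le_right _ _)) hc0 hck

/-- A point reached from `x` outside the orbit of `x` is reached from every point of the
`ω`-limit set of `x`. -/
theorem ChainReach.of_mem_omegaLim {X : Type*} [MetricSpace X] {f : X → X}
    (hf : Continuous f) {x y p : X} (hxy : ChainReach f x y) (hy : ∀ i, f^[i] x ≠ y)
    (hp : p ∈ omegaLim f x) : ChainReach f p y := by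
  intro δ hδ
  obtain ⟨φ, -, hlim⟩ := hp
  obtain ⟨j, hj⟩ :=
    (((hf.tendsto p).comp hlim).eventually (Metric.ball_mem_nhds _ (half_pos hδ))).exists
  obtain ⟨N, hN⟩ : ∃ N, dist (f (f^[N] x)) (f p) < δ / 2 := ⟨φ j, hj⟩
  obtain ⟨δ₁, hδ₁, h₁⟩ := exists_delta_chain_dist_iterate_le hf x (N + 1) (half_pos hδ)
  obtain ⟨δ₂, hδ₂, h₂⟩ := exists_delta_chain_length_gt hf hy N
  obtain ⟨c, k, -, hc, hc0, hck⟩ := hxy (min δ (min δ₁ δ₂)) (lt_min hδ (lt_min hδ₁ hδ₂))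
  have hNk : N < k := h₂ c k
    (fun i hi => (hc i hi).trans ((min_le_right _ _).trans (min_le_right _ _))) hc0 hck
  have hclose := h₁ c k
    (fun i hi => (hc i hi).trans ((min_le_right _ _).trans (min_le_left _ _))) hc0 hNk
  refine ⟨fun i => if i = 0 then p else c (N + i), k - N, by omega, fun i hi => ?_, by simp, ?_⟩
  · rcases Nat.eq_zero_or_pos i with rfl | h0
    · rw [Function.iterate_succ_apply'] at hclose
      rw [dist_comm] at hN hclose
      simp only [if_true, one_ne_zero, if_false, zero_add]
      linarith [dist_triangle (f p) (f (f^[N] x)) (c (N + 1))]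
    · simp only [h0.ne', if_false, Nat.add_eq_zero_iff, one_ne_zero, and_false]
      exact (hc (N + i) (by omega)).trans (min_le_left _ _)
  · have h : k - N ≠ 0 := by omega
    simp [h, Nat.add_sub_cancel' hNk.le, hck]

theorem ChainStable.mem_of_chainReach {X : Type*} [MetricSpace X] {f : X → X} {S : Set X}
    (hS : ChainStable f S) (hS' : IsClosed S) {p y : X} (hp : p ∈ S)
    (hpy : ChainReach f p y) : y ∈ S := by
  refine (hS'.mem_iff_infDist_zero ⟨p, hp⟩).2 (le_antisymm ?_ Metric.infDist_nonneg)
  refine le_of_forall_pos_le_add fun ε hε => ?_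
  obtain ⟨δ, hδ, h⟩ := hS ε hε
  obtain ⟨c, k, hk, hc, rfl, rfl⟩ := hpy δ hδ
  simpa using h c k hk hc hp k le_rfl

/-- Lemma 3.4: if `ω(x,f) ⊆ C` and the chain component `C` is terminal (chain
stable), then `C(x) = {f^i(x) : i ≥ 0} ∪ C`. -/
theorem stmt_14 {X : Type*} [MetricSpace X] [CompactSpace X] (f : X → X)
    (hf : Continuous f) (x : X) (C : Set X) (hC : IsChainComponent f C)
    (hω : omegaLim f x ⊆ C) (hterm : ChainStable f C) :
    CSet f x = {y | ∃ i : ℕ, f^[i] x = y} ∪ C := by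
  obtain ⟨p, hp⟩ := omegaLim_nonempty f x
  apply Subset.antisymm
  · rintro y (rfl | hxy)
    · exact Or.inl ⟨0, rfl⟩
    · by_cases hy : ∃ i : ℕ, f^[i] x = y
      · exact Or.inl hy
      · push Not at hy
        exact Or.inr (hterm.mem_of_chainReach (hC.isClosed hf) (hω hp)
          (hxy.of_mem_omegaLim hf hy hp))
  · rintro y (⟨i, rfl⟩ | hy)
    · rcases Nat.eq_zero_or_pos i with rfl | hi
      · exact Or.inl rfl
      · exact Or.inr (chainReach_iterate f x hi)
    · exact Or.inr ((chainReach_of_mem_omegaLim hp).trans (hC.chainReach (hω hp) hy))
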